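/- Let α ∈ (0,1) be irrational with partial quotients (a_n), with a_n = 1 for only finitely many n. The set V_α of points with a unique representation x = Σ x_n α_n (digits x_n ∈ {0,...,a_n}) has positive Lebesgue measure if and only if Σ_{n≥1} 1/a_n < ∞. -/

import Mathlib

open MeasureTheory

/-- Positive weights `D` satisfying the three-term recurrence with partial quotients `a`. -/
structure OstrowskiScale (a : ℕ → ℕ) (D : ℕ → ℝ) : Prop where
  one_le : ∀ n, 1 ≤ a n
  pos : ∀ n, 0 < D n
  recur : ∀ n, D n = a n * D (n + 1) + D (n + 2)

/-- The tail of the expansion with digits `xs`, starting from position `n`. -/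
noncomputable def ostrowskiTail (D : ℕ → ℝ) (xs : ℕ → ℕ) (n : ℕ) : ℝ :=
  ∑' k : ℕ, (xs (k + n) : ℝ) * D (k + n + 1)

/-- The values of the digit blocks of length `m` starting at position `N`, with the digit at
position `k` taken from `F k`. -/
noncomputable def ostrowskiBlocks (D : ℕ → ℝ) (F : ℕ → Finset ℕ) (N : ℕ) : ℕ → Finset ℝ
  | 0 => {0}
  | m + 1 => Finset.image₂ (fun (s : ℝ) (d : ℕ) => s + d * D (m + N + 1))
      (ostrowskiBlocks D F N m) (F (m + N))

lemma card_ostrowskiBlocks_le (D : ℕ → ℝ) (F : ℕ → Finset ℕ) (N m : ℕ) :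
    (ostrowskiBlocks D F N m).card ≤ ∏ k ∈ Finset.range m, (F (k + N)).card := by
  induction m with
  | zero => simp [ostrowskiBlocks]
  | succ m ih =>
    rw [Finset.prod_range_succ]
    exact (Finset.card_image₂_le _ _ _).trans (Nat.mul_le_mul_right _ ih)

lemma sum_mem_ostrowskiBlocks (D : ℕ → ℝ) (F : ℕ → Finset ℕ) (N m : ℕ) (xs : ℕ → ℕ)
    (h : ∀ k, N ≤ k → xs k ∈ F k) :
    ∑ k ∈ Finset.range m, (xs (k + N) : ℝ) * D (k + N + 1) ∈ ostrowskiBlocks D F N m := by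
  induction m with
  | zero => simp [ostrowskiBlocks]
  | succ m ih =>
    rw [Finset.sum_range_succ]
    exact Finset.mem_image₂_of_mem ih (h _ (by omega))

lemma prod_mul_le_exp_sum (D c e : ℕ → ℝ) (N : ℕ) (hc : ∀ k, 0 ≤ c k)
    (h : ∀ k, c k * D (k + 1) ≤ Real.exp (e k) * D k) (m : ℕ) :
    (∏ k ∈ Finset.range m, c (k + N)) * D (m + N)
      ≤ D N * Real.exp (∑ k ∈ Finset.range m, e (k + N)) := by
  induction m with
  | zero => simp
  | succ m ih =>
    rw [Finset.prod_range_succ, Finset.sum_range_succ, Real.exp_add]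
    have h1 := h (m + N)
    have h2 : 0 ≤ ∏ k ∈ Finset.range m, c (k + N) := Finset.prod_nonneg fun k _ => hc _
    have h3 := mul_le_mul_of_nonneg_left h1 h2
    have h4 := mul_le_mul_of_nonneg_right ih (Real.exp_pos (e (m + N))).le
    rw [show m + 1 + N = m + N + 1 by ring]
    linarith

namespace OstrowskiScale

variable {a : ℕ → ℕ} {D : ℕ → ℝ}

lemma one_le_cast (h : OstrowskiScale a D) (n : ℕ) : (1 : ℝ) ≤ a n := by
  exact_mod_cast h.one_le n

lemma mul_le (h : OstrowskiScale a D) (n : ℕ) : a n * D (n + 1) ≤ D n := by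
  have := h.recur n
  have := h.pos (n + 2)
  linarith

lemma succ_le (h : OstrowskiScale a D) (n : ℕ) : D (n + 1) ≤ D n :=
  (le_mul_of_one_le_left (h.pos _).le (h.one_le_cast n)).trans (h.mul_le n)

lemma antitone (h : OstrowskiScale a D) : Antitone D := antitone_nat_of_succ_le h.succ_le

lemma sum_range (h : OstrowskiScale a D) (n m : ℕ) :
    ∑ k ∈ Finset.range m, (a (k + n) : ℝ) * D (k + n + 1)
      = D n + D (n + 1) - (D (m + n) + D (m + n + 1)) := by
  induction m with
  | zero => simp
  | succ m ih =>
    rw [Finset.sum_range_succ, ih, show m + 1 + n = m + n + 1 by ring]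
    linarith [h.recur (m + n)]

lemma tendsto_zero (h : OstrowskiScale a D) : Filter.Tendsto D Filter.atTop (nhds 0) := by
  have hs : Summable fun k => D (k + 1) := by
    refine summable_of_sum_range_le (c := D 0 + D 1) (fun k => (h.pos _).le) fun m => ?_
    have h1 := h.sum_range 0 m
    have h2 : ∑ k ∈ Finset.range m, D (k + 1)
        ≤ ∑ k ∈ Finset.range m, (a (k + 0) : ℝ) * D (k + 0 + 1) :=
      Finset.sum_le_sum fun k _ => le_mul_of_one_le_left (h.pos _).le (h.one_le_cast k)
    have := h.pos (m + 0)
    have := h.pos (m + 0 + 1)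
    simp only [zero_add] at h1
    linarith
  exact (Filter.tendsto_add_atTop_iff_nat 1).1 hs.tendsto_atTop_zero

lemma tendsto_tail_zero (h : OstrowskiScale a D) (n : ℕ) :
    Filter.Tendsto (fun m => D (m + n) + D (m + n + 1)) Filter.atTop (nhds 0) := by
  have h1 := (Filter.tendsto_add_atTop_iff_nat n).2 h.tendsto_zero
  have h2 := (Filter.tendsto_add_atTop_iff_nat (n + 1)).2 h.tendsto_zero
  simpa [add_assoc] using h1.add h2

lemma hasSum_max (h : OstrowskiScale a D) (n : ℕ) :
    HasSum (fun k => (a (k + n) : ℝ) * D (k + n + 1)) (D n + D (n + 1)) := by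
  rw [hasSum_iff_tendsto_nat_of_nonneg
    fun k => mul_nonneg (Nat.cast_nonneg _) (h.pos _).le]
  simp only [h.sum_range]
  simpa using (h.tendsto_tail_zero n).const_sub (D n + D (n + 1))

lemma term_le (h : OstrowskiScale a D) {xs : ℕ → ℕ} (hx : ∀ n, xs n ≤ a n) (k : ℕ) :
    (xs k : ℝ) * D (k + 1) ≤ a k * D (k + 1) :=
  mul_le_mul_of_nonneg_right (by exact_mod_cast hx k) (h.pos _).le

lemma term_nonneg (h : OstrowskiScale a D) (xs : ℕ → ℕ) (k : ℕ) :
    0 ≤ (xs k : ℝ) * D (k + 1) :=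
  mul_nonneg (Nat.cast_nonneg _) (h.pos _).le

lemma summable (h : OstrowskiScale a D) {xs : ℕ → ℕ} (hx : ∀ n, xs n ≤ a n) (n : ℕ) :
    Summable fun k => (xs (k + n) : ℝ) * D (k + n + 1) :=
  Summable.of_nonneg_of_le (fun _ => h.term_nonneg xs _) (fun _ => h.term_le hx _)
    (h.hasSum_max n).summable

lemma tail_nonneg (h : OstrowskiScale a D) (xs : ℕ → ℕ) (n : ℕ) :
    0 ≤ ostrowskiTail D xs n :=
  tsum_nonneg fun _ => h.term_nonneg xs _

lemma tail_le (h : OstrowskiScale a D) {xs : ℕ → ℕ} (hx : ∀ n, xs n ≤ a n) (n : ℕ) :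
    ostrowskiTail D xs n ≤ D n + D (n + 1) := by
  rw [← (h.hasSum_max n).tsum_eq]
  exact (h.summable hx n).tsum_le_tsum (fun k => h.term_le hx _) (h.hasSum_max n).summable

lemma tail_eq_sum_add (h : OstrowskiScale a D) {xs : ℕ → ℕ} (hx : ∀ n, xs n ≤ a n) (n m : ℕ) :
    ostrowskiTail D xs n
      = ∑ k ∈ Finset.range m, (xs (k + n) : ℝ) * D (k + n + 1) + ostrowskiTail D xs (m + n) := by
  simpa [ostrowskiTail, add_assoc] using ((h.summable hx n).sum_add_tsum_nat_add m).symm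

lemma tail_succ (h : OstrowskiScale a D) {xs : ℕ → ℕ} (hx : ∀ n, xs n ≤ a n) (n : ℕ) :
    ostrowskiTail D xs n = xs n * D (n + 1) + ostrowskiTail D xs (n + 1) := by
  simpa [add_comm 1 n] using h.tail_eq_sum_add hx n 1

lemma exists_digit (h : OstrowskiScale a D) (n : ℕ) (y : ℝ) (hy : 0 ≤ y)
    (hy' : y ≤ D n + D (n + 1)) :
    ∃ d : ℕ, d ≤ a n ∧ 0 ≤ y - d * D (n + 1) ∧ y - d * D (n + 1) ≤ D (n + 1) + D (n + 2) := by
  have hp := h.pos (n + 1)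
  have hp2 := h.pos (n + 2)
  have hr := h.recur n
  have h1 : (⌊y / D (n + 1)⌋₊ : ℝ) * D (n + 1) ≤ y :=
    (le_div_iff₀ hp).1 (Nat.floor_le (by positivity))
  have h2 : y < (⌊y / D (n + 1)⌋₊ + 1 : ℝ) * D (n + 1) :=
    (div_lt_iff₀ hp).1 (Nat.lt_floor_add_one _)
  by_cases hc : ⌊y / D (n + 1)⌋₊ ≤ a n
  · exact ⟨_, hc, by linarith, by linarith⟩
  · refine ⟨a n, le_rfl, ?_, by linarith⟩
    have h3 : (a n : ℝ) ≤ ⌊y / D (n + 1)⌋₊ := by exact_mod_cast (not_le.1 hc).le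
    have := mul_le_mul_of_nonneg_right h3 hp.le
    linarith

lemma exists_tail_eq (h : OstrowskiScale a D) (n : ℕ) (y : ℝ) (hy : 0 ≤ y)
    (hy' : y ≤ D n + D (n + 1)) :
    ∃ zs : ℕ → ℕ, (∀ k, zs k ≤ a k) ∧ ostrowskiTail D zs n = y := by
  choose! d hd hd0 hd1 using h.exists_digit
  let r : ℕ → ℝ := fun k => Nat.rec y (fun k r => r - d (k + n) r * D (k + n + 1)) k
  have hr : ∀ k, r (k + 1) = r k - d (k + n) (r k) * D (k + n + 1) := fun k => rfl
  have hb : ∀ k, 0 ≤ r k ∧ r k ≤ D (k + n) + D (k + n + 1) := by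
    intro k
    induction k with
    | zero => simpa using ⟨hy, hy'⟩
    | succ k ih =>
      rw [hr, show k + 1 + n = k + n + 1 by ring]
      exact ⟨hd0 _ _ ih.1 ih.2, hd1 _ _ ih.1 ih.2⟩
  refine ⟨fun k => if n ≤ k then d k (r (k - n)) else 0, fun k => ?_, ?_⟩
  · by_cases hk : n ≤ k
    · have hbk := hb (k - n)
      rw [Nat.sub_add_cancel hk] at hbk
      simpa [hk] using hd k _ hbk.1 hbk.2
    · simp [hk]
  · simp only [ostrowskiTail, Nat.le_add_left, if_true, Nat.add_sub_cancel]
    refine HasSum.tsum_eq ?_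
    rw [hasSum_iff_tendsto_nat_of_nonneg
      fun k => mul_nonneg (Nat.cast_nonneg _) (h.pos _).le]
    have hs : ∀ m, ∑ k ∈ Finset.range m, (d (k + n) (r k) : ℝ) * D (k + n + 1) = y - r m := by
      intro m
      induction m with
      | zero => simp [r]
      | succ m ih => rw [Finset.sum_range_succ, ih, hr]; ring
    simp only [hs]
    have := squeeze_zero (fun k => (hb k).1) (fun k => (hb k).2) (h.tendsto_tail_zero n)
    simpa using this.const_sub y

/-- Any admissible value of the tail can be realised without changing the first `n` digits. -/
lemma exists_splice (h : OstrowskiScale a D) {xs : ℕ → ℕ} (hx : ∀ n, xs n ≤ a n) (n e : ℕ)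
    (he : e ≤ a n) (h0 : 0 ≤ ostrowskiTail D xs n - e * D (n + 1))
    (h1 : ostrowskiTail D xs n - e * D (n + 1) ≤ D (n + 1) + D (n + 2)) :
    ∃ ys : ℕ → ℕ, (∀ k, ys k ≤ a k) ∧ ostrowskiTail D ys 0 = ostrowskiTail D xs 0 ∧
      ys n = e := by
  obtain ⟨zs, hz, hzy⟩ := h.exists_tail_eq (n + 1) _ h0 h1
  let ys : ℕ → ℕ := fun k => if k < n then xs k else if k = n then e else zs k
  have hys : ∀ k, ys k ≤ a k := by
    intro k
    simp only [ys]
    split_ifs with h1 h2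
    · exact hx k
    · exact h2 ▸ he
    · exact hz k
  have hn : ys n = e := by simp [ys]
  refine ⟨ys, hys, ?_, hn⟩
  have ht : ostrowskiTail D ys (n + 1) = ostrowskiTail D zs (n + 1) := by
    unfold ostrowskiTail
    refine tsum_congr fun k => ?_
    have : ys (k + (n + 1)) = zs (k + (n + 1)) := by
      simp only [ys]
      rw [if_neg (by omega), if_neg (by omega)]
    rw [this]
  rw [h.tail_eq_sum_add hys 0 n, h.tail_eq_sum_add hx 0 n, add_zero, h.tail_succ hys n, hn, ht,
    hzy]
  have : ∑ k ∈ Finset.range n, (ys (k + 0) : ℝ) * D (k + 0 + 1)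
      = ∑ k ∈ Finset.range n, (xs (k + 0) : ℝ) * D (k + 0 + 1) := by
    refine Finset.sum_congr rfl fun k hk => ?_
    have : ys (k + 0) = xs (k + 0) := by
      simp only [ys]
      rw [if_pos (by simpa using hk)]
    rw [this]
  rw [this]
  ring

lemma one_le_succ_of_unique (h : OstrowskiScale a D) {xs : ℕ → ℕ} (hx : ∀ n, xs n ≤ a n)
    (hu : ∀ ys : ℕ → ℕ, (∀ n, ys n ≤ a n) →
      ostrowskiTail D ys 0 = ostrowskiTail D xs 0 → ys = xs)
    (n : ℕ) (hn : 1 ≤ xs n) : 1 ≤ xs (n + 1) := by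
  by_contra hc
  have hz : xs (n + 1) = 0 := by omega
  have e1 := h.tail_succ hx n
  have e2 := h.tail_succ hx (n + 1)
  have b := h.tail_le hx (n + 2)
  have b0 := h.tail_nonneg xs (n + 1)
  have p1 := h.pos (n + 1)
  have p2 := h.pos (n + 2)
  have p3 := h.pos (n + 3)
  simp only [hz, Nat.cast_zero, zero_mul, zero_add, add_assoc, Nat.reduceAdd] at e1 e2 b
  by_cases hy : ostrowskiTail D xs (n + 1) < D (n + 2)
  · obtain ⟨ys, hy1, hy2, hy3⟩ := h.exists_splice hx n (xs n - 1) (by have := hx n; omega)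
      (by rw [Nat.cast_sub hn]; push_cast; nlinarith)
      (by rw [Nat.cast_sub hn]; push_cast; nlinarith)
    have := congrFun (hu ys hy1 hy2) n
    omega
  · obtain ⟨ys, hy1, hy2, hy3⟩ := h.exists_splice hx (n + 1) 1 (h.one_le _)
      (by push_cast; simp only [add_assoc, Nat.reduceAdd]; linarith)
      (by push_cast; simp only [add_assoc, Nat.reduceAdd]; linarith)
    have := congrFun (hu ys hy1 hy2) (n + 1)
    omega

lemma tail_compl (h : OstrowskiScale a D) {xs : ℕ → ℕ} (hx : ∀ n, xs n ≤ a n) :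
    ostrowskiTail D (fun k => a k - xs k) 0 = D 0 + D 1 - ostrowskiTail D xs 0 := by
  have h1 := (h.hasSum_max 0).sub (h.summable hx 0).hasSum
  rw [ostrowskiTail, ← zero_add 1]
  refine Eq.trans (tsum_congr fun k => ?_) h1.tsum_eq
  simp only [Nat.cast_sub (hx _)]
  ring

lemma succ_lt_of_unique (h : OstrowskiScale a D) {xs : ℕ → ℕ} (hx : ∀ n, xs n ≤ a n)
    (hu : ∀ ys : ℕ → ℕ, (∀ n, ys n ≤ a n) →
      ostrowskiTail D ys 0 = ostrowskiTail D xs 0 → ys = xs)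
    (n : ℕ) (hn : xs n < a n) : xs (n + 1) < a (n + 1) := by
  have hc : ∀ k, a k - xs k ≤ a k := fun k => Nat.sub_le _ _
  have := h.one_le_succ_of_unique hc (fun ys hy hs => ?_) n (by omega)
  · omega
  · have h1 := hu (fun k => a k - ys k) (fun k => Nat.sub_le _ _) (by
      rw [h.tail_compl hy, hs, h.tail_compl hx]; ring)
    funext k
    have h2 := congrFun h1 k
    have h3 := hy k
    omega

/-- A unique expansion of an interior point eventually avoids the extreme digits. -/
lemma exists_forall_mem_Icc_of_unique (h : OstrowskiScale a D) {xs : ℕ → ℕ}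
    (hx : ∀ n, xs n ≤ a n)
    (hu : ∀ ys : ℕ → ℕ, (∀ n, ys n ≤ a n) →
      ostrowskiTail D ys 0 = ostrowskiTail D xs 0 → ys = xs)
    (h0 : 0 < ostrowskiTail D xs 0) (h1 : ostrowskiTail D xs 0 < D 0 + D 1) :
    ∃ N, ∀ k, N ≤ k → xs k ∈ Finset.Icc 1 (a k - 1) := by
  obtain ⟨n, hn⟩ : ∃ n, 1 ≤ xs n := by
    by_contra! hc
    have : xs = 0 := funext fun k => by simpa using hc k
    simp [this, ostrowskiTail] at h0
  obtain ⟨m, hm⟩ : ∃ m, xs m < a m := by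
    by_contra! hc
    have : xs = a := funext fun k => le_antisymm (hx k) (hc k)
    have h2 := (h.hasSum_max 0).tsum_eq
    rw [this, ostrowskiTail, h2] at h1
    exact lt_irrefl _ h1
  refine ⟨max n m, fun k hk => ?_⟩
  have e1 : 1 ≤ xs k := Nat.le_induction (P := fun k _ => 1 ≤ xs k) hn
    (fun k _ => h.one_le_succ_of_unique hx hu k) k (le_of_max_le_left hk)
  have e2 : xs k < a k := Nat.le_induction (P := fun k _ => xs k < a k) hm
    (fun k _ => h.succ_lt_of_unique hx hu k) k (le_of_max_le_right hk)
  rw [Finset.mem_Icc]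
  omega

lemma volume_biUnion_Icc_le (S : Finset ℝ) (l : ℝ) :
    volume (⋃ s ∈ S, Set.Icc s (s + l)) ≤ ENNReal.ofReal (S.card * l) := by
  refine (measure_biUnion_finset_le _ _).trans ?_
  simp [ENNReal.ofReal_mul]

/-- The tails all of whose digits are neither minimal nor maximal form a null set. -/
lemma volume_interior_tails (h : OstrowskiScale a D)
    (hs : ¬ Summable fun n => (1 : ℝ) / a n) (N : ℕ) :
    volume {y : ℝ | ∃ xs : ℕ → ℕ, (∀ n, xs n ≤ a n) ∧
      (∀ k, N ≤ k → xs k ∈ Finset.Icc 1 (a k - 1)) ∧ y = ostrowskiTail D xs N} = 0 := by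
  have hc : ∀ k, ((a k - 1 : ℕ) : ℝ) * D (k + 1) ≤ Real.exp (-(1 / a k)) * D k := by
    intro k
    have hk := h.one_le_cast k
    have e1 := Real.add_one_le_exp (-(1 / (a k : ℝ)))
    have e2 : ((a k - 1 : ℕ) : ℝ) * D (k + 1) = (-(1 / (a k : ℝ)) + 1) * (a k * D (k + 1)) := by
      rw [Nat.cast_sub (h.one_le k)]
      field_simp
      push_cast
      ring
    rw [e2]
    have := h.pos (k + 1)
    exact mul_le_mul e1 (h.mul_le k) (by positivity) (Real.exp_pos _).le
  have hbound : ∀ m, volume {y : ℝ | ∃ xs : ℕ → ℕ, (∀ n, xs n ≤ a n) ∧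
      (∀ k, N ≤ k → xs k ∈ Finset.Icc 1 (a k - 1)) ∧ y = ostrowskiTail D xs N}
      ≤ ENNReal.ofReal (2 * (D N * Real.exp (-∑ k ∈ Finset.range m, (1 : ℝ) / a (k + N)))) := by
    intro m
    let S := ostrowskiBlocks D (fun k => Finset.Icc 1 (a k - 1)) N m
    refine le_trans (measure_mono (t := ⋃ s ∈ S, Set.Icc s (s + 2 * D (m + N))) ?_)
      ((volume_biUnion_Icc_le _ _).trans (ENNReal.ofReal_le_ofReal ?_))
    · rintro y ⟨xs, hx, hi, rfl⟩
      simp only [Set.mem_iUnion, Set.mem_Icc]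
      refine ⟨_, sum_mem_ostrowskiBlocks D _ N m xs hi, ?_⟩
      have e := h.tail_eq_sum_add hx N m
      have := h.tail_nonneg xs (m + N)
      have := h.tail_le hx (m + N)
      have := h.succ_le (m + N)
      constructor <;> linarith
    · have h1 : (S.card : ℝ) ≤ ∏ k ∈ Finset.range m, ((a (k + N) - 1 : ℕ) : ℝ) := by
        have := card_ostrowskiBlocks_le D (fun k => Finset.Icc 1 (a k - 1)) N m
        simp only [Nat.card_Icc, Nat.add_sub_cancel] at this
        exact_mod_cast this
      have h2 := prod_mul_le_exp_sum D (fun k => ((a k - 1 : ℕ) : ℝ)) (fun k => -(1 / (a k : ℝ))) N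
        (fun k => Nat.cast_nonneg _) hc m
      rw [Finset.sum_neg_distrib] at h2
      have h3 := mul_le_mul_of_nonneg_right h1 (h.pos (m + N)).le
      linarith
  have hdiv : Filter.Tendsto (fun m => ∑ k ∈ Finset.range m, (1 : ℝ) / a (k + N))
      Filter.atTop Filter.atTop := by
    rw [← not_summable_iff_tendsto_nat_atTop_of_nonneg fun k => by positivity]
    exact fun hs' => hs ((summable_nat_add_iff (f := fun n => (1 : ℝ) / a n) N).1 hs')
  have hlim := ENNReal.tendsto_ofReal
    (((Real.tendsto_exp_neg_atTop_nhds_zero.comp hdiv).const_mul (D N)).const_mul 2)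
  simp only [mul_zero, ENNReal.ofReal_zero] at hlim
  exact le_antisymm (ge_of_tendsto' hlim hbound) zero_le

lemma volume_unique_eq_zero (h : OstrowskiScale a D)
    (hs : ¬ Summable fun n => (1 : ℝ) / a n) :
    volume {x : ℝ | x ∈ Set.Ioo 0 (D 0 + D 1) ∧
      ∃! xs : ℕ → ℕ, (∀ n, xs n ≤ a n) ∧ x = ostrowskiTail D xs 0} = 0 := by
  let E : ℕ → Set ℝ := fun N => {y : ℝ | ∃ xs : ℕ → ℕ, (∀ n, xs n ≤ a n) ∧
      (∀ k, N ≤ k → xs k ∈ Finset.Icc 1 (a k - 1)) ∧ y = ostrowskiTail D xs N}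
  let S : ℕ → Finset ℝ := ostrowskiBlocks D (fun k => Finset.range (a k + 1)) 0
  refine measure_mono_null (t := ⋃ N, ⋃ s ∈ S N, (fun x => x + -s) ⁻¹' E N) ?_ ?_
  · rintro x ⟨hx, xs, ⟨hxa, rfl⟩, hu⟩
    obtain ⟨N, hN⟩ := h.exists_forall_mem_Icc_of_unique hxa
      (fun ys hy he => hu ys ⟨hy, he.symm⟩) hx.1 hx.2
    simp only [Set.mem_iUnion]
    refine ⟨N, _, sum_mem_ostrowskiBlocks D _ 0 N xs
      (fun k _ => Finset.mem_range.2 (Nat.lt_succ_of_le (hxa k))), xs, hxa, hN, ?_⟩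
    have := h.tail_eq_sum_add hxa 0 N
    rw [add_zero] at this
    rw [this]
    ring
  · refine measure_iUnion_null fun N => (measure_biUnion_null_iff (S N).countable_toSet).2
      fun s _ => ?_
    rw [measure_preimage_add_right]
    exact h.volume_interior_tails hs N

/-- Two distinct expansions of a point less than `D N` place it in a short interval. -/
lemma exists_overlap (h : OstrowskiScale a D) {xs ys : ℕ → ℕ} (hx : ∀ n, xs n ≤ a n)
    (hy : ∀ n, ys n ≤ a n) (hne : xs ≠ ys)
    (he : ostrowskiTail D xs 0 = ostrowskiTail D ys 0) {N : ℕ}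
    (hN : ostrowskiTail D xs 0 < D N) :
    ∃ m, ∃ s ∈ ostrowskiBlocks D (fun k => Finset.range (a k + 1)) N m,
      ∃ d ∈ Finset.Icc 1 (a (m + N)),
        ostrowskiTail D xs 0 ∈
          Set.Icc (s + d * D (m + N + 1)) (s + d * D (m + N + 1) + D (m + N + 2)) := by
  have hzero : ∀ zs : ℕ → ℕ, (∀ n, zs n ≤ a n) → ostrowskiTail D zs 0 < D N →
      ∀ k < N, zs k = 0 := by
    intro zs hz hlt k hk
    by_contra hc
    have h1 : (1 : ℝ) ≤ zs k := by exact_mod_cast Nat.one_le_iff_ne_zero.2 hc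
    have h2 : (zs k : ℝ) * D (k + 1) ≤ ostrowskiTail D zs 0 :=
      (h.summable hz 0).le_tsum k fun j _ => h.term_nonneg zs _
    have h3 : D N ≤ D (k + 1) := h.antitone hk
    have h4 := le_mul_of_one_le_left (h.pos (k + 1)).le h1
    linarith
  have htail : ∀ zs : ℕ → ℕ, (∀ n, zs n ≤ a n) → ostrowskiTail D zs 0 < D N →
      ostrowskiTail D zs 0 = ostrowskiTail D zs N := by
    intro zs hz hlt
    rw [h.tail_eq_sum_add hz 0 N, add_zero, Finset.sum_eq_zero, zero_add]
    intro k hk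
    simp [hzero zs hz hlt k (Finset.mem_range.1 hk)]
  have hex : ∃ n, xs n ≠ ys n := Function.ne_iff.1 hne
  classical
  let n := Nat.find hex
  have hn : xs n ≠ ys n := Nat.find_spec hex
  have hmin : ∀ k < n, xs k = ys k := fun k hk => not_not.1 (Nat.find_min hex hk)
  have hNn : N ≤ n := by
    by_contra! hc
    exact hn ((hzero xs hx hN n hc).trans (hzero ys hy (he ▸ hN) n hc).symm)
  clear_value n
  wlog hlt : xs n < ys n generalizing xs ys
  · rw [he]
    exact this hy hx hne.symm he.symm (he ▸ hN) ⟨n, hn.symm⟩ hn.symm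
      (fun k hk => (hmin k hk).symm) (by omega)
  obtain ⟨m, rfl⟩ := Nat.exists_eq_add_of_le' hNn
  refine ⟨m, _, sum_mem_ostrowskiBlocks D _ N m ys
    (fun k _ => Finset.mem_range.2 (Nat.lt_succ_of_le (hy k))), ys (m + N),
    Finset.mem_Icc.2 ⟨by omega, hy _⟩, ?_⟩
  have e1 := h.tail_eq_sum_add hx N m
  have e2 := h.tail_eq_sum_add hy N m
  rw [← htail xs hx hN, h.tail_succ hx (m + N)] at e1
  rw [← htail ys hy (he ▸ hN), h.tail_succ hy (m + N)] at e2
  have hsum : ∑ k ∈ Finset.range m, (xs (k + N) : ℝ) * D (k + N + 1)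
      = ∑ k ∈ Finset.range m, (ys (k + N) : ℝ) * D (k + N + 1) := by
    refine Finset.sum_congr rfl fun k hk => ?_
    rw [hmin (k + N) (by have := Finset.mem_range.1 hk; omega)]
  have h1 := h.tail_nonneg ys (m + N + 1)
  have h2 := h.tail_le hx (m + N + 1)
  have h3 : (xs (m + N) : ℝ) + 1 ≤ ys (m + N) := by exact_mod_cast hlt
  have h4 := mul_le_mul_of_nonneg_right h3 (h.pos (m + N + 1)).le
  rw [show m + N + 1 + 1 = m + N + 2 by ring] at h2
  constructor <;> linarith

lemma card_blocks_mul_le (h : OstrowskiScale a D) (N m : ℕ) :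
    ((ostrowskiBlocks D (fun k => Finset.range (a k + 1)) N m).card : ℝ) * D (m + N)
      ≤ D N * Real.exp (∑ k ∈ Finset.range m, (1 : ℝ) / a (k + N)) := by
  have hc : ∀ k, ((a k + 1 : ℕ) : ℝ) * D (k + 1) ≤ Real.exp (1 / a k) * D k := by
    intro k
    have hk := h.one_le_cast k
    have e1 := Real.add_one_le_exp (1 / (a k : ℝ))
    have e2 : ((a k + 1 : ℕ) : ℝ) * D (k + 1) = (1 / (a k : ℝ) + 1) * (a k * D (k + 1)) := by
      push_cast
      field_simp
      ring
    rw [e2]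
    have := h.pos (k + 1)
    exact mul_le_mul e1 (h.mul_le k) (by positivity) (Real.exp_pos _).le
  have h1 : ((ostrowskiBlocks D (fun k => Finset.range (a k + 1)) N m).card : ℝ)
      ≤ ∏ k ∈ Finset.range m, ((a (k + N) + 1 : ℕ) : ℝ) := by
    have := card_ostrowskiBlocks_le D (fun k => Finset.range (a k + 1)) N m
    simp only [Finset.card_range] at this
    exact_mod_cast this
  exact (mul_le_mul_of_nonneg_right h1 (h.pos _).le).trans
    (prod_mul_le_exp_sum D (fun k => ((a k + 1 : ℕ) : ℝ)) (fun k => 1 / (a k : ℝ)) N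
      (fun k => Nat.cast_nonneg _) hc m)

lemma volume_overlaps_lt (h : OstrowskiScale a D) {N : ℕ}
    (hs : Summable fun k => (1 : ℝ) / a (k + N))
    (hN : ∑' k, (1 : ℝ) / a (k + N) < 1 / 2) :
    volume (⋃ m, ⋃ s ∈ ostrowskiBlocks D (fun k => Finset.range (a k + 1)) N m,
      ⋃ d ∈ Finset.Icc 1 (a (m + N)),
        Set.Icc (s + d * D (m + N + 1)) (s + d * D (m + N + 1) + D (m + N + 2)))
      < ENNReal.ofReal (D N) := by
  set ε := ∑' k, (1 : ℝ) / a (k + N) with hε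
  have hε0 : 0 ≤ ε := tsum_nonneg fun k => by positivity
  have hs1 : Summable fun m => (1 : ℝ) / a (m + 1 + N) :=
    (summable_nat_add_iff (f := fun m => (1 : ℝ) / a (m + N)) 1).2 hs
  have hle : ∑' m, (1 : ℝ) / a (m + 1 + N) ≤ ε := by
    have h0 := hs.sum_add_tsum_nat_add 1
    have : (0 : ℝ) ≤ 1 / a (0 + N) := by positivity
    simp only [Finset.sum_range_one] at h0
    linarith
  have hterm : ∀ m, volume (⋃ s ∈ ostrowskiBlocks D (fun k => Finset.range (a k + 1)) N m,
      ⋃ d ∈ Finset.Icc 1 (a (m + N)),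
        Set.Icc (s + d * D (m + N + 1)) (s + d * D (m + N + 1) + D (m + N + 2)))
      ≤ ENNReal.ofReal (D N * Real.exp ε * (1 / a (m + 1 + N))) := by
    intro m
    set S := ostrowskiBlocks D (fun k => Finset.range (a k + 1)) N m with hS
    have h1 : ∀ s : ℝ, volume (⋃ d ∈ Finset.Icc 1 (a (m + N)),
        Set.Icc (s + d * D (m + N + 1)) (s + d * D (m + N + 1) + D (m + N + 2)))
        ≤ ENNReal.ofReal (a (m + N) * D (m + N + 2)) := by
      intro s
      refine (measure_biUnion_finset_le _ _).trans ?_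
      simp [ENNReal.ofReal_mul]
    have h2 : volume (⋃ s ∈ S, ⋃ d ∈ Finset.Icc 1 (a (m + N)),
        Set.Icc (s + d * D (m + N + 1)) (s + d * D (m + N + 1) + D (m + N + 2)))
        ≤ ENNReal.ofReal (S.card * (a (m + N) * D (m + N + 2))) := by
      refine (measure_biUnion_finset_le _ _).trans ((Finset.sum_le_sum fun s _ => h1 s).trans ?_)
      simp [ENNReal.ofReal_mul]
    refine h2.trans (ENNReal.ofReal_le_ofReal ?_)
    have h3 := h.card_blocks_mul_le N m
    have h4 : D N * Real.exp (∑ k ∈ Finset.range m, (1 : ℝ) / a (k + N))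
        ≤ D N * Real.exp ε :=
      mul_le_mul_of_nonneg_left (Real.exp_le_exp.2
        (hs.sum_le_tsum _ fun k _ => by positivity)) (h.pos N).le
    have ha := h.one_le_cast (m + 1 + N)
    have h5 : (a (m + N) : ℝ) * D (m + N + 2) ≤ D (m + N) * (1 / a (m + 1 + N)) := by
      rw [mul_one_div, le_div_iff₀ (by linarith)]
      have h6 := h.mul_le (m + N + 1)
      have h7 := h.mul_le (m + N)
      have h8 := mul_le_mul_of_nonneg_left h6 (Nat.cast_nonneg (α := ℝ) (a (m + N)))
      rw [show m + 1 + N = m + N + 1 by ring]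
      rw [show m + N + 1 + 1 = m + N + 2 by ring] at h8
      linarith
    calc (S.card : ℝ) * (a (m + N) * D (m + N + 2))
        ≤ S.card * (D (m + N) * (1 / a (m + 1 + N))) :=
          mul_le_mul_of_nonneg_left h5 (Nat.cast_nonneg _)
      _ = S.card * D (m + N) * (1 / a (m + 1 + N)) := by ring
      _ ≤ D N * Real.exp ε * (1 / a (m + 1 + N)) :=
          mul_le_mul_of_nonneg_right (h3.trans h4) (by positivity)
  have hD := h.pos N
  refine ((measure_iUnion_le _).trans (ENNReal.tsum_le_tsum hterm)).trans_lt ?_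
  rw [← ENNReal.ofReal_tsum_of_nonneg (fun m => by positivity) (hs1.mul_left _), tsum_mul_left]
  rw [ENNReal.ofReal_lt_ofReal_iff hD]
  have hexp : Real.exp ε * ε < 1 := by
    have h1 : Real.exp ε * Real.exp (-ε) = 1 := by rw [← Real.exp_add]; simp
    have h2 := Real.add_one_le_exp (-ε)
    have h3 : ε < Real.exp (-ε) := by linarith
    calc Real.exp ε * ε < Real.exp ε * Real.exp (-ε) :=
          mul_lt_mul_of_pos_left h3 (Real.exp_pos _)
      _ = 1 := h1
  calc D N * Real.exp ε * ∑' m, (1 : ℝ) / a (m + 1 + N)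
      ≤ D N * Real.exp ε * ε := mul_le_mul_of_nonneg_left hle (by positivity)
    _ = D N * (Real.exp ε * ε) := by ring
    _ < D N * 1 := mul_lt_mul_of_pos_left hexp hD
    _ = D N := mul_one _

lemma volume_unique_pos (h : OstrowskiScale a D)
    (hs : Summable fun n => (1 : ℝ) / a n) :
    0 < volume {x : ℝ | x ∈ Set.Ioo 0 (D 0) ∧
      ∃! xs : ℕ → ℕ, (∀ n, xs n ≤ a n) ∧ x = ostrowskiTail D xs 0} := by
  obtain ⟨N, hN⟩ := ((tendsto_sum_nat_add fun n => (1 : ℝ) / a n).eventually_lt_const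
    (by norm_num : (0 : ℝ) < 1 / 2)).exists
  have hlt := h.volume_overlaps_lt
    ((summable_nat_add_iff (f := fun n => (1 : ℝ) / a n) N).2 hs) hN
  rw [pos_iff_ne_zero]
  intro hzero
  refine hlt.not_ge ?_
  have hvol : ENNReal.ofReal (D N) = volume (Set.Ioo 0 (D N)) := by simp
  rw [hvol]
  refine (measure_mono fun x hx => ?_).trans
    ((measure_union_le _ _).trans_eq ((congrArg (· + _) hzero).trans (zero_add _)))
  obtain ⟨xs, hxa, rfl⟩ := h.exists_tail_eq 0 x hx.1.le
    (by linarith [hx.2, h.antitone (Nat.zero_le N), h.pos (0 + 1)])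
  by_cases hu : ∀ ys : ℕ → ℕ, (∀ n, ys n ≤ a n) ∧
      ostrowskiTail D xs 0 = ostrowskiTail D ys 0 → ys = xs
  · exact Or.inl ⟨⟨hx.1, hx.2.trans_le (h.antitone (Nat.zero_le N))⟩, xs, ⟨hxa, rfl⟩, hu⟩
  · push Not at hu
    obtain ⟨ys, ⟨hya, he⟩, hne⟩ := hu
    obtain ⟨m, s, hs, d, hd, hmem⟩ := h.exists_overlap hxa hya hne.symm he hx.2
    refine Or.inr ?_
    simp only [Set.mem_iUnion]
    exact ⟨m, s, hs, d, hd, hmem⟩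

end OstrowskiScale

/-- in the Ostrowski setting, with only finitely many partial quotients
equal to `1`, the set `V_α` of uniquely representable points has positive Lebesgue
measure iff `Σ 1/a_n < ∞`. -/
theorem unique_ostrowski_positive_measure_iff
    (α : ℝ) (hα : α ∈ Set.Ioo (0 : ℝ) 1) (hirr : Irrational α)
    (a : ℕ → ℕ) (ha : ∀ n, 1 ≤ a n)
    (D : ℕ → ℝ) (hD0 : D 0 = 1) (hD1 : D 1 = α) (hpos : ∀ n, 0 < D n)
    (hrec : ∀ n, D n = a n * D (n + 1) + D (n + 2))
    (hfin : {n : ℕ | a n = 1}.Finite) :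
    0 < volume {x : ℝ | x ∈ Set.Ioo (0 : ℝ) 1 ∧
        ∃! xs : ℕ → ℕ, (∀ n, xs n ≤ a n) ∧ x = ∑' n : ℕ, (xs n : ℝ) * D (n + 1)} ↔
      Summable (fun n : ℕ => (1 : ℝ) / (a n : ℝ)) := by
  have h : OstrowskiScale a D := ⟨ha, hpos, hrec⟩
  constructor
  · intro hv
    by_contra hs
    refine hv.ne' (measure_mono_null ?_ (h.volume_unique_eq_zero hs))
    rintro x ⟨hx, hu⟩
    exact ⟨⟨hx.1, by rw [hD0]; linarith [hx.2, hpos 1]⟩, hu⟩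
  · intro hs
    have hv := h.volume_unique_pos hs
    rw [hD0] at hv
    exact hv
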